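/- arXiv:1309.0353 — 9 statements merged into one kernel-verified Lean document; each statement's English description precedes it below -/
import Mathlib

section
/- Let D be a division ring which is finite-dimensional over its center F, and let K be a subfield of D containing F. Let Δ be the centralizer of K in D, and regard D as a right Δ-module via right multiplication. Then the map Φ : D ⊗_F K → End_Δ(D) determined by Φ(x ⊗ k)(y) = x·y·k is an isomorphism of K-algebras, where End_Δ(D) denotes the ring of right-Δ-linear endomorphisms of D and its K-algebra structure is given by letting k ∈ K act as right multiplication by k. -/
open scoped TensorProduct

/-- The ring of right-`Δ`-linear endomorphisms of `D` (additive endomorphisms commuting with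
right multiplication by elements of the subring `Δ`), as a subring of `AddMonoid.End D`. -/
def rightEnd {D : Type*} [Ring D] (Δ : Subring D) : Subring (AddMonoid.End D) where
  carrier := {f | ∀ (y : D), ∀ δ ∈ Δ, f (y * δ) = f y * δ}
  mul_mem' := by
    intro f g hf hg y δ hδ
    have : (f * g) (y * δ) = f (g (y * δ)) := rfl
    rw [this, hg y δ hδ, hf _ δ hδ]
    rfl
  one_mem' := by intro y δ hδ; rfl
  add_mem' := by
    intro f g hf hg y δ hδ
    show f (y * δ) + g (y * δ) = (f y + g y) * δ
    rw [hf y δ hδ, hg y δ hδ, add_mul]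
  zero_mem' := by
    intro y δ hδ
    show (0 : D) = 0 * δ
    rw [zero_mul]
  neg_mem' := by
    intro f hf y δ hδ
    show -(f (y * δ)) = -(f y) * δ
    rw [hf y δ hδ, neg_mul]

section sandwich

open MulOpposite

variable {F A D : Type*} [Field F] [Ring A] [DivisionRing D] [Algebra F A] [Algebra F D]

/-- For an algebra map `ρ : A → Dᵐᵒᵖ`, the action of `D ⊗[F] A` on `D` given by
`(x ⊗ a) • y = x * y * ρ a`. -/
noncomputable def sandwich (ρ : A →ₐ[F] Dᵐᵒᵖ) : D ⊗[F] A →ₐ[F] Module.End F D :=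
  (AlgHom.mulLeftRight F D).comp (Algebra.TensorProduct.map (AlgHom.id F D) ρ)

@[simp]
lemma sandwich_tmul (ρ : A →ₐ[F] Dᵐᵒᵖ) (x : D) (a : A) (y : D) :
    sandwich ρ (x ⊗ₜ a) y = x * y * (ρ a).unop := by
  simp [sandwich]

lemma isSimpleModule_range_sandwich (ρ : A →ₐ[F] Dᵐᵒᵖ) :
    IsSimpleModule (sandwich ρ).range D := by
  refine isSimpleModule_iff_toSpanSingleton_surjective.mpr ⟨inferInstance, fun v hv y ↦ ?_⟩
  refine ⟨⟨_, (y * v⁻¹) ⊗ₜ 1, rfl⟩, ?_⟩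
  change sandwich ρ ((y * v⁻¹) ⊗ₜ 1) v = y
  simp [hv]

lemma mem_range_sandwich [FiniteDimensional F D] (ρ : A →ₐ[F] Dᵐᵒᵖ) (f : Module.End F D)
    (hf : ∀ δ : D, (∀ a, (ρ a).unop * δ = δ * (ρ a).unop) → ∀ y, f (y * δ) = f y * δ) :
    f ∈ (sandwich ρ).range := by
  have := isSimpleModule_range_sandwich ρ
  have map_sandwich (g : Module.End (sandwich ρ).range D) (t : D ⊗[F] A) (y : D) :
      g (sandwich ρ t y) = sandwich ρ t (g y) := g.map_smul ⟨_, t, rfl⟩ y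
  have apply_eq (g : Module.End (sandwich ρ).range D) (y : D) : g y = y * g 1 := by
    simpa using map_sandwich g (y ⊗ₜ 1) 1
  have comm (g : Module.End (sandwich ρ).range D) (a : A) :
      (ρ a).unop * g 1 = g 1 * (ρ a).unop := by
    rw [← apply_eq]
    simpa using map_sandwich g (1 ⊗ₜ a) 1
  let f' : Module.End (Module.End (sandwich ρ).range D) D :=
    { toFun := f
      map_add' := map_add f
      map_smul' := fun g y ↦ by
        change f (g y) = g (f y)
        rw [apply_eq g y, apply_eq g (f y), hf _ (comm g)] }
  obtain ⟨s, hs⟩ := Module.Finite.fg_top (R := F) (M := D)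
  obtain ⟨r, hr⟩ := jacobson_density (R := (sandwich ρ).range) f' s
  have : f = r.1 := LinearMap.ext_on hs fun m hm ↦ hr m hm
  exact this ▸ r.2

lemma mulLeftRight_injective [FiniteDimensional F D] (hcenter : Subalgebra.center F D = ⊥) :
    Function.Injective (AlgHom.mulLeftRight F D) := by
  have eq : sandwich (AlgHom.id F Dᵐᵒᵖ) = AlgHom.mulLeftRight F D := by
    ext <;> simp
  have surj : Function.Surjective (AlgHom.mulLeftRight F D) := by
    intro f
    rw [← eq]
    refine mem_range_sandwich _ f fun δ hδ y ↦ ?_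
    have hmem : δ ∈ Subalgebra.center F D :=
      Subalgebra.mem_center_iff.mpr fun b ↦ by simpa using hδ (op b)
    rw [hcenter] at hmem
    obtain ⟨c, rfl⟩ := Algebra.mem_bot.mp hmem
    rw [← Algebra.commutes, ← Algebra.commutes, ← Algebra.smul_def, ← Algebra.smul_def, map_smul]
  have hdim : Module.finrank F (D ⊗[F] Dᵐᵒᵖ) = Module.finrank F (Module.End F D) := by
    rw [Module.finrank_tensorProduct, Module.finrank_linearMap,
      ← (opLinearEquiv F : D ≃ₗ[F] Dᵐᵒᵖ).finrank_eq]
  exact (LinearMap.injective_iff_surjective_of_finrank_eq_finrank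
    (f := (AlgHom.mulLeftRight F D).toLinearMap) hdim).mpr surj

lemma sandwich_injective [FiniteDimensional F D] (hcenter : Subalgebra.center F D = ⊥)
    (ρ : A →ₐ[F] Dᵐᵒᵖ) (hρ : Function.Injective ρ) : Function.Injective (sandwich ρ) :=
  (mulLeftRight_injective hcenter).comp
    (Module.Flat.lTensor_preserves_injective_linearMap (M := D) ρ.toLinearMap hρ)

end sandwich

/-- Let `D` be a division ring, finite-dimensional over its center `F`, and `ι : K → D` a
subfield of `D` containing `F` (an `F`-algebra embedding of a field `K`).  Let `Δ` be the
centralizer of `K` in `D`.  Then the map `Φ : D ⊗[F] K → End_Δ(D)` with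
`Φ (x ⊗ k) (y) = x * y * ι k` is an isomorphism of `K`-algebras: it is a ring isomorphism, and
`k` acts on the source as multiplication by `1 ⊗ k` and on the target as right multiplication
by `ι k`, which correspond under the displayed formula. -/
theorem stmt_1 {F K D : Type*} [Field F] [Field K] [DivisionRing D]
    [Algebra F K] [Algebra F D] [FiniteDimensional F D]
    (hcenter : Subalgebra.center F D = ⊥)
    (ι : K →ₐ[F] D) :
    ∃ Φ : (D ⊗[F] K) ≃+* rightEnd (Subring.centralizer (Set.range ⇑ι)),
      ∀ (x : D) (k : K) (y : D),
        ((Φ (x ⊗ₜ[F] k) : AddMonoid.End D)) y = x * y * ι k := by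
  let ρ : K →ₐ[F] Dᵐᵒᵖ := ι.toOpposite fun x y ↦ (Commute.all x y).map ι
  have sandwich_mem (t : D ⊗[F] K) :
      Module.toAddMonoidEnd (Module.End F D) D (sandwich ρ t) ∈
        rightEnd (Subring.centralizer (Set.range ⇑ι)) := by
    intro y δ hδ
    change sandwich ρ t (y * δ) = sandwich ρ t y * δ
    induction t with
    | zero => simp
    | tmul x k =>
      have h : ι k * δ = δ * ι k := Subring.mem_centralizer_iff.mp hδ _ ⟨k, rfl⟩
      simp [ρ, mul_assoc, h]
    | add a b ha hb => simp [ha, hb, add_mul]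
  let φ : D ⊗[F] K →+* rightEnd (Subring.centralizer (Set.range ⇑ι)) :=
    ((Module.toAddMonoidEnd (Module.End F D) D).comp (sandwich ρ).toRingHom).codRestrict _
      sandwich_mem
  have φ_apply (t : D ⊗[F] K) (y : D) : (φ t : AddMonoid.End D) y = sandwich ρ t y := rfl
  have φ_bijective : Function.Bijective φ := by
    constructor
    · intro s t h
      refine sandwich_injective hcenter ρ (MulOpposite.op_injective.comp ι.injective)
        (LinearMap.ext fun y ↦ ?_)
      rw [← φ_apply, ← φ_apply, h]
    · intro f
      let f' : Module.End F D :=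
        { toFun := f.1
          map_add' := map_add f.1
          map_smul' := fun c y ↦ by
            have hc : algebraMap F D c ∈ Subring.centralizer (Set.range ⇑ι) :=
              Subring.mem_centralizer_iff.mpr fun b _ ↦ (Algebra.commutes c b).symm
            rw [RingHom.id_apply, Algebra.smul_def, Algebra.smul_def, Algebra.commutes,
              Algebra.commutes, f.2 y _ hc] }
      obtain ⟨t, ht⟩ := mem_range_sandwich ρ f' fun δ hδ y ↦ f.2 y δ <|
        Subring.mem_centralizer_iff.mpr <| by
          rintro _ ⟨k, rfl⟩
          exact hδ k
      exact ⟨t, Subtype.ext <| AddMonoidHom.ext fun y ↦ LinearMap.congr_fun ht y⟩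
  refine ⟨RingEquiv.ofBijective φ φ_bijective, fun x k y ↦ ?_⟩
  rw [RingEquiv.ofBijective_apply, φ_apply, sandwich_tmul]
  rfl
end

section
/- Let D be a division ring with center F such that dim_F D = d² is finite, and let K ⊆ D be a subfield with F ⊆ K and [K : F] = 2. Let Δ be the centralizer of K in D. Then d is even, Δ is a division ring whose center is exactly K, dim_K Δ = (d/2)², and D is a right Δ-vector space of dimension 2. -/
open BigOperators

section QuadraticCommutator

variable {D : Type*} [DivisionRing D] {a e t n : D}

theorem exists_decomp_of_quadratic (ht : ∀ x, t * x = x * t) (hn : ∀ x, n * x = x * n)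
    (ha : a * a = t * a - n) (he : a * e ≠ e * a) (y : D) :
    ∃ p q : D, a * p = p * a ∧ a * q = q * a ∧ y = p + e * q := by
  have twist : ∀ x, a * (a * x - x * a) = (a * x - x * a) * (t - a) := fun x ↦ by
    have h1 : a * (a * x) = t * a * x - n * x := by rw [← mul_assoc, ha, sub_mul]
    have h2 : x * a * a = x * t * a - x * n := by rw [mul_assoc, ha, mul_sub, mul_assoc]
    have h3 : a * x * t = t * a * x := by rw [← ht, mul_assoc]
    have h4 : x * a * t = x * t * a := by rw [mul_assoc, ← ht, mul_assoc]
    have h5 : a * x * a = a * (x * a) := mul_assoc _ _ _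
    rw [mul_sub, mul_sub, sub_mul, sub_mul, h1, h2, h3, h4, h5, hn x]
    abel
  have h0 : a * e - e * a ≠ 0 := sub_ne_zero.2 he
  obtain ⟨q, hq⟩ : ∃ q, a * y - y * a = (a * e - e * a) * q :=
    ⟨(a * e - e * a)⁻¹ * (a * y - y * a), (mul_inv_cancel_left₀ h0 _).symm⟩
  have hqa : a * q = q * a := by
    have h := twist y
    rw [hq, ← mul_assoc, twist e, mul_assoc, mul_assoc, mul_right_inj' h0, sub_mul, mul_sub,
      ht q] at h
    exact sub_right_injective h
  refine ⟨y - e * q, q, ?_, hqa, (sub_add_cancel _ _).symm⟩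
  have h : a * y - y * a = a * (e * q) - e * q * a := by
    rw [hq, sub_mul, mul_assoc, mul_assoc, mul_assoc, hqa]
  rw [mul_sub, sub_mul]
  rw [sub_eq_sub_iff_add_eq_add] at h ⊢
  rw [h, add_comm]

theorem eq_zero_of_add_mul_eq_zero (he : a * e ≠ e * a) {p q : D} (hp : a * p = p * a)
    (hq : a * q = q * a) (h : p + e * q = 0) : p = 0 ∧ q = 0 := by
  have hq0 : q = 0 := by
    by_contra hne
    have h1 : a * (e * q) = e * q * a := by
      rw [eq_neg_of_add_eq_zero_right h, mul_neg, neg_mul, hp]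
    rw [mul_assoc, ← hq, ← mul_assoc, ← mul_assoc] at h1
    exact he (mul_right_cancel₀ hne h1)
  subst hq0
  simpa using h

theorem exists_central_of_commute_centralizer (ht : ∀ x, t * x = x * t)
    (hn : ∀ x, n * x = x * n) (ha : a * a = t * a - n) (he : a * e ≠ e * a) {x : D}
    (hx : ∀ z, a * z = z * a → x * z = z * x) :
    ∃ c : D, (∀ v, c * v = v * c) ∧ ∀ v, (x - c * a) * v = v * (x - c * a) := by
  have h0 : a * e - e * a ≠ 0 := sub_ne_zero.2 he
  obtain ⟨c, hc⟩ : ∃ c, x * e - e * x = c * (a * e - e * a) :=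
    ⟨(x * e - e * x) * (a * e - e * a)⁻¹, (inv_mul_cancel_right₀ h0 _).symm⟩
  have key : ∀ w, x * w - w * x = c * (a * w - w * a) := fun w ↦ by
    obtain ⟨p, q, hp, hq, rfl⟩ := exists_decomp_of_quadratic ht hn ha he w
    have h1 : x * (p + e * q) - (p + e * q) * x = (x * e - e * x) * q := by
      rw [mul_add, add_mul, hx p hp, mul_assoc e, ← hx q hq]; noncomm_ring
    have h2 : a * (p + e * q) - (p + e * q) * a = (a * e - e * a) * q := by
      rw [mul_add, add_mul, hp, mul_assoc e, ← hq]; noncomm_ring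
    rw [h1, h2, hc, mul_assoc]
  have hcv : ∀ v, c * v = v * c := fun v ↦ by
    have h1 : x * (v * e) - v * e * x = (x * v - v * x) * e + v * (x * e - e * x) := by
      noncomm_ring
    have h2 : a * (v * e) - v * e * a = (a * v - v * a) * e + v * (a * e - e * a) := by
      noncomm_ring
    rw [key (v * e), key v, key e, h2, mul_add, mul_assoc c (a * v - v * a), add_right_inj,
      ← mul_assoc, ← mul_assoc] at h1
    exact mul_right_cancel₀ h0 h1
  refine ⟨c, hcv, fun v ↦ ?_⟩
  have h := key v
  rw [mul_sub, ← mul_assoc, ← mul_assoc, hcv v, mul_assoc v c a] at h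
  rw [sub_mul, mul_sub, sub_eq_sub_iff_sub_eq_sub, h]

end QuadraticCommutator

theorem exists_generator_of_finrank_eq_two {F K : Type*} [Field F] [Field K] [Algebra F K]
    (hK : Module.finrank F K = 2) :
    ∃ α : K, α ∉ Set.range (algebraMap F K) ∧
      ∀ k : K, ∃ f g : F, k = algebraMap F K f + algebraMap F K g * α := by
  have : FiniteDimensional F K := Module.finite_of_finrank_pos (by omega)
  obtain ⟨α, hα⟩ : ∃ α : K, α ∉ Set.range (algebraMap F K) := by
    by_contra! h
    have : Module.finrank F K ≤ 1 := finrank_le_one (1 : K) fun k ↦ by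
      obtain ⟨f, rfl⟩ := h k
      exact ⟨f, by rw [Algebra.smul_def, mul_one]⟩
    omega
  have hli : LinearIndependent F ![(1 : K), α] := by
    rw [LinearIndependent.pair_iff' one_ne_zero]
    intro f hf
    exact hα ⟨f, by rw [← hf, Algebra.smul_def, mul_one]⟩
  have hspan := hli.span_eq_top_of_card_eq_finrank' (by simp [hK])
  refine ⟨α, hα, fun k ↦ ?_⟩
  have hk : k ∈ Submodule.span F (Set.range ![(1 : K), α]) := hspan ▸ Submodule.mem_top
  rw [Matrix.range_cons, Matrix.range_cons, Matrix.range_empty, Set.union_empty,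
    Set.singleton_union, Submodule.mem_span_pair] at hk
  obtain ⟨f, g, rfl⟩ := hk
  exact ⟨f, g, by rw [Algebra.smul_def, Algebra.smul_def, mul_one]⟩

/-- Let `D` be a division ring with center `F` and `dim_F D = d²`, and let `ι : K → D` be a
quadratic subfield of `D` containing `F` (an `F`-algebra embedding of a field `K` with
`[K : F] = 2`).  Let `Δ` be the centralizer of `K` in `D`.  Then `d` is even, `Δ` is a
division ring (a subring closed under inversion) whose center is exactly `K`, `Δ` has a
`K`-basis of cardinality `(d/2)²` (i.e. `dim_K Δ = (d/2)²`), and `D` has a basis of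
cardinality `2` as a right `Δ`-vector space. -/
theorem stmt_2 {F K D : Type*} [Field F] [Field K] [DivisionRing D]
    [Algebra F K] [Algebra F D] [FiniteDimensional F D] (d : ℕ)
    (hcenter : Subalgebra.center F D = ⊥)
    (hdim : Module.finrank F D = d ^ 2)
    (hK : Module.finrank F K = 2)
    (ι : K →ₐ[F] D) :
    Even d ∧
    (∀ x ∈ Subring.centralizer (Set.range ⇑ι), x ≠ 0 →
        x⁻¹ ∈ Subring.centralizer (Set.range ⇑ι)) ∧
    ({x : D | x ∈ Subring.centralizer (Set.range ⇑ι) ∧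
        ∀ y ∈ Subring.centralizer (Set.range ⇑ι), x * y = y * x} = Set.range ⇑ι) ∧
    (∃ b : Fin ((d / 2) ^ 2) → D,
        (∀ i, b i ∈ Subring.centralizer (Set.range ⇑ι)) ∧
        ∀ x ∈ Subring.centralizer (Set.range ⇑ι),
          ∃! c : Fin ((d / 2) ^ 2) → K, x = ∑ i, ι (c i) * b i) ∧
    (∃ e : Fin 2 → D, ∀ y : D, ∃! p : Fin 2 → D,
        (∀ i, p i ∈ Subring.centralizer (Set.range ⇑ι)) ∧ y = ∑ i, e i * p i) := by
  obtain ⟨α, hα, hgen⟩ := exists_generator_of_finrank_eq_two hK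
  have hcomm : ∀ (f : F) (x : D), algebraMap F D f * x = x * algebraMap F D f :=
    Algebra.commutes
  have hcent : ∀ x : D, (∀ y, x * y = y * x) → ∃ f : F, algebraMap F D f = x := fun x hx ↦ by
    have : x ∈ Subalgebra.center F D :=
      Subalgebra.mem_center_iff.2 fun y ↦ (hx y).symm
    rwa [hcenter, Algebra.mem_bot] at this
  have hmem : ∀ x : D, x ∈ Subring.centralizer (Set.range ⇑ι) ↔ ι α * x = x * ι α := by
    intro x
    rw [Subring.mem_centralizer_iff]
    refine ⟨fun h ↦ h _ ⟨α, rfl⟩, ?_⟩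
    rintro h _ ⟨k, rfl⟩
    obtain ⟨f, g, rfl⟩ := hgen k
    rw [map_add, map_mul, AlgHom.commutes, AlgHom.commutes, add_mul, mul_add, hcomm,
      mul_assoc, h, ← mul_assoc, hcomm, mul_assoc]
  obtain ⟨n, t, hnt⟩ := hgen (α * α)
  have ht := hcomm t
  have hn := hcomm (-n)
  have ha : ι α * ι α = algebraMap F D t * ι α - algebraMap F D (-n) := by
    rw [← map_mul, hnt, map_add, map_mul, AlgHom.commutes, AlgHom.commutes, map_neg,
      sub_neg_eq_add, add_comm]
  obtain ⟨e, he⟩ : ∃ e, ι α * e ≠ e * ι α := by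
    by_contra! h
    obtain ⟨f, hf⟩ := hcent _ h
    exact hα ⟨f, ι.injective ((ι.commutes f).trans hf)⟩
  let _ : Module K D := Module.compHom D ι.toRingHom
  have hsmul : ∀ (k : K) (x : D), k • x = ι k * x := fun _ _ ↦ rfl
  have : IsScalarTower F K D := ⟨fun f k x ↦ by
    rw [hsmul, hsmul, map_smul, smul_mul_assoc]⟩
  let Δ : Submodule K D :=
    { carrier := {x | ι α * x = x * ι α}
      add_mem' := fun {x y} hx hy ↦ by
        simp only [Set.mem_ofPred_eq] at *
        rw [mul_add, add_mul, hx, hy]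
      zero_mem' := by simp
      smul_mem' := fun k x hx ↦ by
        simp only [Set.mem_ofPred_eq] at *
        rw [hsmul, ← mul_assoc, ← map_mul, mul_comm, map_mul, mul_assoc, hx, mul_assoc] }
  have hΔ : ∀ x, x ∈ Δ ↔ ι α * x = x * ι α := fun _ ↦ Iff.rfl
  have hdec := exists_decomp_of_quadratic ht hn ha he
  let φ : (Δ × Δ) →ₗ[F] D :=
    { toFun := fun p ↦ (p.1 : D) + e * p.2
      map_add' := fun p q ↦ by
        simp only [Prod.fst_add, Prod.snd_add, Submodule.coe_add, mul_add]
        abel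
      map_smul' := fun f p ↦ by
        simp }
  have hφ : Function.Bijective φ := by
    constructor
    · rw [injective_iff_map_eq_zero]
      intro p hp
      obtain ⟨h1, h2⟩ := eq_zero_of_add_mul_eq_zero he p.1.2 p.2.2 hp
      exact Prod.ext (Subtype.ext h1) (Subtype.ext h2)
    · intro y
      obtain ⟨p, q, hp, hq, rfl⟩ := hdec y
      exact ⟨(⟨p, hp⟩, ⟨q, hq⟩), rfl⟩
  have : FiniteDimensional F Δ :=
    inferInstanceAs (FiniteDimensional F (Δ.restrictScalars F))
  have : FiniteDimensional K Δ := Module.Finite.of_restrictScalars_finite F K Δ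
  have hfin : d ^ 2 = 4 * Module.finrank K Δ := by
    rw [← hdim, ← (LinearEquiv.ofBijective φ hφ).finrank_eq, Module.finrank_prod,
      ← Module.finrank_mul_finrank F K Δ, hK]
    ring
  have heven : Even d := by
    have : Even (d ^ 2) := ⟨2 * Module.finrank K Δ, by omega⟩
    exact (Nat.even_pow.1 this).1
  have hrank : Module.finrank K Δ = (d / 2) ^ 2 := by
    obtain ⟨m, rfl⟩ := heven
    rw [← two_mul, Nat.mul_div_cancel_left _ two_pos]
    nlinarith
  refine ⟨heven, ?_, ?_, ?_, ?_⟩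
  · intro x hx _
    rw [hmem] at *
    exact (Commute.inv_right₀ (show Commute (ι α) x from hx)).eq
  · ext x
    constructor
    · rintro ⟨-, hx⟩
      obtain ⟨c, hc, hxc⟩ := exists_central_of_commute_centralizer ht hn ha he
        fun z hz ↦ hx z ((hmem z).2 hz)
      obtain ⟨g, rfl⟩ := hcent c hc
      obtain ⟨f, hf⟩ := hcent _ hxc
      refine ⟨algebraMap F K f + algebraMap F K g * α, ?_⟩
      rw [map_add, map_mul, AlgHom.commutes, AlgHom.commutes, hf, sub_add_cancel]
    · rintro ⟨k, rfl⟩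
      refine ⟨(hmem _).2 (by rw [← map_mul, mul_comm, map_mul]), fun y hy ↦ ?_⟩
      exact Subring.mem_centralizer_iff.1 hy _ ⟨k, rfl⟩
  · let b := Module.finBasisOfFinrankEq K Δ hrank
    refine ⟨fun i ↦ b i, fun i ↦ (hmem _).2 (b i).2, fun x hx ↦ ?_⟩
    have hsum : ∀ c : Fin ((d / 2) ^ 2) → K,
        ((∑ i, c i • b i : Δ) : D) = ∑ i, ι (c i) * (b i : D) := fun c ↦ by
      rw [Submodule.coe_sum]
      rfl
    refine ⟨b.repr ⟨x, (hmem x).1 hx⟩, ?_, fun c hc ↦ ?_⟩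
    · simp only
      rw [← hsum, b.sum_repr]
    · have h : (⟨x, (hmem x).1 hx⟩ : Δ) = ∑ i, c i • b i := Subtype.ext (by rw [hsum]; exact hc)
      rw [h, b.repr_sum_self]
  · refine ⟨![1, e], fun y ↦ ?_⟩
    obtain ⟨p, q, hp, hq, rfl⟩ := hdec y
    refine ⟨![p, q], ⟨?_, by simp⟩, ?_⟩
    · simpa [Fin.forall_fin_two, hmem] using ⟨hp, hq⟩
    · rintro r ⟨hr, hrs⟩
      simp only [hmem] at hr
      have h : (⟨⟨r 0, hr 0⟩, ⟨r 1, hr 1⟩⟩ : Δ × Δ) = ⟨⟨p, hp⟩, ⟨q, hq⟩⟩ := by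
        refine hφ.1 ?_
        simpa [φ, Fin.sum_univ_two] using hrs.symm
      simp only [Prod.mk.injEq, Subtype.mk.injEq] at h
      ext i
      fin_cases i
      · exact h.1
      · exact h.2
end

section
/- Let D be a division ring which is finite-dimensional over its center F, let K be a subfield of D containing F, and let σ be an F-algebra automorphism of K. Then there exists a nonzero d₀ ∈ D such that d₀·k·d₀⁻¹ = σ(k) for all k ∈ K. Moreover, for any such d₀, a nonzero element d₀' ∈ D satisfies d₀'·k·(d₀')⁻¹ = σ(k) for all k ∈ K if and only if d₀⁻¹·d₀' lies in the centralizer of K in D; that is, d₀ is unique up to right multiplication by a nonzero element of the centralizer of K in D. -/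
open scoped TensorProduct

/-- Over a division algebra with center `F`, a vanishing generalized polynomial
`x ↦ ∑ aᵢ x bᵢ` with `b` linearly independent over `F` has all `aᵢ` equal to zero. -/
theorem eq_zero_of_forall_sum_mul_mul_eq_zero {F D ι : Type*} [Field F] [DivisionRing D]
    [Algebra F D] (hcenter : Subalgebra.center F D = ⊥) {b : ι → D} (hb : LinearIndependent F b)
    (s : Finset ι) (a : ι → D) (h : ∀ x, ∑ i ∈ s, a i * x * b i = 0) : ∀ i ∈ s, a i = 0 := by
  classical
  induction s using Finset.induction_on generalizing a with
  | empty => simp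
  | insert j s hj ih =>
    by_cases haj : a j = 0
    · simp only [Finset.sum_insert hj, haj, zero_mul, zero_add] at h
      simpa [haj] using ih a h
    exfalso
    have hcomm (y : D) : ∀ i ∈ s, y * ((a j)⁻¹ * a i) - (a j)⁻¹ * a i * y = 0 := by
      refine ih _ fun x => ?_
      have h₁ := congr(y * (a j)⁻¹ * $(h x))
      have h₂ := congr((a j)⁻¹ * $(h (y * x)))
      simp only [Finset.sum_insert hj, mul_add, mul_zero, Finset.mul_sum] at h₁ h₂
      have h₃ : y * (a j)⁻¹ * (a j * x * b j) = (a j)⁻¹ * (a j * (y * x) * b j) := by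
        simp only [mul_assoc, inv_mul_cancel_left₀ haj]
      rw [h₃] at h₁
      rw [← sub_eq_zero.mpr (h₁.trans h₂.symm), add_sub_add_left_eq_sub, ← Finset.sum_sub_distrib]
      refine Finset.sum_congr rfl fun i _ => ?_
      noncomm_ring
    have hscalar : ∀ i ∈ insert j s, ∃ c : F, algebraMap F D c = (a j)⁻¹ * a i := by
      intro i hi
      change _ ∈ Set.range (algebraMap F D)
      rw [← Algebra.mem_bot, ← hcenter, Subalgebra.mem_center_iff]
      intro y
      rcases Finset.mem_insert.mp hi with rfl | hi
      · simp [haj]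
      · exact sub_eq_zero.mp (hcomm y i hi)
    choose! c hc using hscalar
    have hsum : ∑ i ∈ insert j s, c i • b i = 0 := by
      rw [← mul_zero (a j)⁻¹, ← h 1, Finset.mul_sum]
      refine Finset.sum_congr rfl fun i hi => ?_
      rw [Algebra.smul_def, hc i hi, mul_one, mul_assoc]
    have hcj := linearIndependent_iff'.mp hb _ c hsum j (Finset.mem_insert_self j s)
    have := hc j (Finset.mem_insert_self j s)
    simp [hcj, haj] at this

section TwoSidedAction

variable {F K D : Type*} [Field F] [Field K] [DivisionRing D] [Algebra F K] [Algebra F D]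

/-- The action of `K ⊗ K` on `D` given by `(k ⊗ l) • x = f k * x * g l`. -/
noncomputable def twoSidedAction (f g : K →ₐ[F] D) : K ⊗[F] K →ₐ[F] Module.End F D :=
  Algebra.TensorProduct.lift ((Algebra.lmul F D).comp f)
    (AlgHom.ofLinearMap ((LinearMap.mul F D).flip ∘ₗ g.toLinearMap)
      (by ext; simp)
      (fun k l => by ext x; simp [mul_comm k l, mul_assoc]))
    (fun k l => by ext x; simp [mul_assoc])

theorem twoSidedAction_tmul (f g : K →ₐ[F] D) (k l : K) (x : D) :
    twoSidedAction f g (k ⊗ₜ l) x = f k * x * g l := by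
  refine (LinearMap.congr_fun (Algebra.TensorProduct.lift_tmul _ _ _ k l) x).trans ?_
  simp [mul_assoc]

theorem twoSidedAction_injective (hcenter : Subalgebra.center F D = ⊥) (f g : K →ₐ[F] D) :
    Function.Injective (twoSidedAction f g) := by
  rw [injective_iff_map_eq_zero]
  intro t ht
  let B := Module.Basis.ofVectorSpace F K
  obtain ⟨c, rfl⟩ := TensorProduct.eq_repr_basis_right B t
  have hgB : LinearIndependent F (fun i => g (B i)) :=
    B.linearIndependent.map' g.toLinearMap (LinearMap.ker_eq_bot.mpr g.injective)
  have hc := eq_zero_of_forall_sum_mul_mul_eq_zero hcenter hgB c.support (fun i => f (c i))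
    fun x => by
      simpa [Finsupp.sum, twoSidedAction_tmul] using congr($ht x)
  refine Finset.sum_eq_zero fun i hi => ?_
  simp [(map_eq_zero f).mp (hc i hi)]

/-- **Skolem–Noether** for two embeddings of a field into a central division algebra. -/
theorem exists_ne_zero_forall_mul_eq_mul [FiniteDimensional F D]
    (hcenter : Subalgebra.center F D = ⊥) (f g : K →ₐ[F] D) :
    ∃ d : D, d ≠ 0 ∧ ∀ k, d * g k = f k * d := by
  have : FiniteDimensional F K := FiniteDimensional.of_injective f.toLinearMap f.injective
  have : IsArtinianRing (K ⊗[F] K) := IsArtinianRing.of_finite F _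
  let _ : Module (K ⊗[F] K) D := Module.compHom D (twoSidedAction f g).toRingHom
  have smul_def (t : K ⊗[F] K) (x : D) : t • x = twoSidedAction f g t x := rfl
  have : IsScalarTower F (K ⊗[F] K) D := ⟨fun c t x => by simp [smul_def]⟩
  have : Module.Finite (K ⊗[F] K) D := Module.Finite.of_restrictScalars_finite F _ _
  have hann : Module.annihilator (K ⊗[F] K) D = ⊥ := by
    rw [eq_bot_iff]
    intro t ht
    refine twoSidedAction_injective hcenter f g ?_
    ext x
    simpa [smul_def] using Module.mem_annihilator.mp ht x
  let μ : K ⊗[F] K →ₐ[F] K := Algebra.TensorProduct.lmul' F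
  have hprime : (RingHom.ker μ).IsPrime := RingHom.ker_isPrime μ
  have hassoc : RingHom.ker μ ∈ associatedPrimes (K ⊗[F] K) D :=
    Module.associatedPrimes.minimalPrimes_annihilator_subset_associatedPrimes _ _ <| by
      rw [hann]
      exact IsArtinianRing.mem_minimalPrimes bot_le
  obtain ⟨-, d, hd⟩ := isAssociatedPrime_iff.mp hassoc
  refine ⟨d, ?_, fun k => ?_⟩
  · rintro rfl
    exact hprime.ne_top (hd.trans (by simp))
  · have hk : 1 ⊗ₜ k - k ⊗ₜ 1 ∈ RingHom.ker μ := by simp [μ, RingHom.mem_ker]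
    rw [hd, Submodule.mem_colon_singleton, Submodule.mem_bot, smul_def, map_sub,
      LinearMap.sub_apply, twoSidedAction_tmul, twoSidedAction_tmul, sub_eq_zero] at hk
    simpa using hk

end TwoSidedAction

/-- Skolem–Noether for subfields: let `D` be a division ring, finite-dimensional over its
center `F`, let `ι : K → D` be a subfield of `D` containing `F` (an `F`-algebra embedding of
a field `K`), and let `σ` be an `F`-algebra automorphism of `K`.  Then there exists a nonzero
`d₀ ∈ D` with `d₀ * ι k * d₀⁻¹ = ι (σ k)` for all `k`; moreover, for any such `d₀`, a nonzero
`d₀'` satisfies the same identity if and only if `d₀⁻¹ * d₀'` lies in the centralizer of `K`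
in `D`. -/
theorem stmt_3 {F K D : Type*} [Field F] [Field K] [DivisionRing D]
    [Algebra F K] [Algebra F D] [FiniteDimensional F D]
    (hcenter : Subalgebra.center F D = ⊥)
    (ι : K →ₐ[F] D) (σ : K ≃ₐ[F] K) :
    (∃ d₀ : D, d₀ ≠ 0 ∧ ∀ k : K, d₀ * ι k * d₀⁻¹ = ι (σ k)) ∧
    (∀ d₀ : D, d₀ ≠ 0 → (∀ k : K, d₀ * ι k * d₀⁻¹ = ι (σ k)) →
      ∀ d₀' : D, d₀' ≠ 0 →
        ((∀ k : K, d₀' * ι k * d₀'⁻¹ = ι (σ k)) ↔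
          d₀⁻¹ * d₀' ∈ Subring.centralizer (Set.range ⇑ι))) := by
  refine ⟨?_, fun d hd h d' hd' => ?_⟩
  · obtain ⟨d, hd, h⟩ := exists_ne_zero_forall_mul_eq_mul hcenter (ι.comp σ.toAlgHom) ι
    exact ⟨d, hd, fun k => by simp [h k, hd]⟩
  · rw [Subring.mem_centralizer_iff, Set.forall_mem_range]
    refine forall_congr' fun k => ?_
    rw [← h k, mul_inv_eq_iff_eq_mul₀ hd', eq_comm]
    constructor
    · intro hk
      rw [mul_assoc, ← hk]
      simp [mul_assoc, hd]
    · intro hk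
      rw [mul_assoc, mul_assoc, hk]
      simp [mul_assoc, hd]
end

section
/- Let m ≥ 1. Let q : ℝ^m → V denote the canonical projection onto the quotient V of ℝ^m by the line ℝ·(1,…,1); a point of V is called integral if it lies in q(ℤ^m). For 0 ≤ i ≤ m−1 let P_i = q(0,…,0,2,…,2), the image of the vector with m−i coordinates equal to 0 followed by i coordinates equal to 2. Then the set of integral points of the convex hull of {P_0, …, P_{m−1}} in V is exactly {P_i : 0 ≤ i ≤ m−1} ∪ {(P_k + P_l)/2 : 0 ≤ k < l ≤ m−1}; these points are pairwise distinct, so the convex hull contains exactly m(m+1)/2 integral points, and explicitly (P_k + P_l)/2 = q(0,…,0,1,…,1,2,…,2) with m−l zeros, l−k ones and k twos. -/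
namespace ChamberIntegralPoints

/-- The vector with `m - i` coordinates equal to `0` followed by `i` coordinates equal to `2`. -/
def stepVec (m i : ℕ) : Fin m → ℝ := fun j => if (j : ℕ) < m - i then 0 else 2

/-- The line spanned by the all-ones vector. -/
abbrev line (m : ℕ) : Submodule ℝ (Fin m → ℝ) := Submodule.span ℝ {(1 : Fin m → ℝ)}

/-- The class of `stepVec m i` modulo the line. -/
def stepPt (m : ℕ) (i : Fin m) : (Fin m → ℝ) ⧸ line m := (line m).mkQ (stepVec m i)

/-- The integral points of the quotient. -/
def integralPts (m : ℕ) : Set ((Fin m → ℝ) ⧸ line m) :=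
  (line m).mkQ '' {v : Fin m → ℝ | ∀ j, ∃ z : ℤ, v j = (z : ℝ)}

theorem mkQ_eq_iff {m : ℕ} (v w : Fin m → ℝ) :
    (line m).mkQ v = (line m).mkQ w ↔ ∃ c : ℝ, ∀ j, v j = w j + c := by
  rw [Submodule.mkQ_apply, Submodule.mkQ_apply, Submodule.Quotient.eq,
    Submodule.mem_span_singleton]
  refine exists_congr fun c => ?_
  rw [funext_iff]
  refine forall_congr' fun j => ?_
  simp only [Pi.smul_apply, Pi.one_apply, smul_eq_mul, mul_one, Pi.sub_apply]
  constructor <;> intro h <;> linarith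

theorem stepVec_of_lt {m i : ℕ} {j : Fin m} (h : (j : ℕ) < m - i) : stepVec m i j = 0 := if_pos h

theorem stepVec_of_not_lt {m i : ℕ} {j : Fin m} (h : ¬(j : ℕ) < m - i) : stepVec m i j = 2 :=
  if_neg h

theorem stepVec_nonneg (m i : ℕ) (j : Fin m) : 0 ≤ stepVec m i j := by
  unfold stepVec; split_ifs <;> norm_num

theorem stepVec_le_two (m i : ℕ) (j : Fin m) : stepVec m i j ≤ 2 := by
  unfold stepVec; split_ifs <;> norm_num

theorem stepVec_monotone (m i : ℕ) : Monotone (stepVec m i) := by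
  intro a b hab
  by_cases h : (a : ℕ) < m - i
  · rw [stepVec_of_lt h]
    exact stepVec_nonneg m i b
  · have hb : ¬(b : ℕ) < m - i := fun hb => h (lt_of_le_of_lt hab hb)
    rw [stepVec_of_not_lt h, stepVec_of_not_lt hb]

theorem stepVec_zero {m : ℕ} (hm : 1 ≤ m) (i : Fin m) : stepVec m i ⟨0, hm⟩ = 0 :=
  stepVec_of_lt (by have := i.2; simp only; omega)

/-- The midpoint of two step points is the class of the midpoint of the step vectors. -/
theorem midpoint_eq {m : ℕ} (k l : Fin m) :
    (2⁻¹ : ℝ) • (stepPt m k + stepPt m l) =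
      (line m).mkQ ((2⁻¹ : ℝ) • (stepVec m k + stepVec m l)) := by
  simp only [stepPt, map_smul, map_add]

theorem midpoint_self {m : ℕ} (k : Fin m) :
    (2⁻¹ : ℝ) • (stepPt m k + stepPt m k) = stepPt m k := by
  rw [← two_smul ℝ, smul_smul]
  norm_num

/-- The normalised monotone vectors with values in `[0, 2]`. -/
def monoBox (m : ℕ) (hm : 1 ≤ m) : Set (Fin m → ℝ) :=
  {w | w ⟨0, hm⟩ = 0 ∧ Monotone w ∧ ∀ j, 0 ≤ w j ∧ w j ≤ 2}

theorem convex_monoBox {m : ℕ} (hm : 1 ≤ m) : Convex ℝ (monoBox m hm) := by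
  rintro v ⟨hv0, hv, hv2⟩ w ⟨hw0, hw, hw2⟩ a b ha hb hab
  refine ⟨by simp [hv0, hw0], fun i j hij => ?_, fun j => ?_⟩
  · simp only [Pi.add_apply, Pi.smul_apply, smul_eq_mul]
    exact add_le_add (mul_le_mul_of_nonneg_left (hv hij) ha)
      (mul_le_mul_of_nonneg_left (hw hij) hb)
  · simp only [Pi.add_apply, Pi.smul_apply, smul_eq_mul]
    obtain ⟨h1, h2⟩ := hv2 j
    obtain ⟨h3, h4⟩ := hw2 j
    constructor
    · positivity
    · nlinarith

theorem convexHull_subset {m : ℕ} (hm : 1 ≤ m) :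
    convexHull ℝ (Set.range (stepPt m)) ⊆ (line m).mkQ '' monoBox m hm := by
  refine convexHull_min ?_ ((convex_monoBox hm).linear_image _)
  rintro _ ⟨i, rfl⟩
  exact ⟨stepVec m i, ⟨stepVec_zero hm i, stepVec_monotone m i,
    fun j => ⟨stepVec_nonneg m i j, stepVec_le_two m i j⟩⟩, rfl⟩

/-- A downward closed predicate on `Fin m` holding at `0` is cut out by a threshold `m - k`. -/
theorem exists_threshold {m : ℕ} (hm : 1 ≤ m) (p : Fin m → Prop) (hp : Antitone p)
    (h0 : p ⟨0, hm⟩) : ∃ k : Fin m, ∀ j : Fin m, p j ↔ (j : ℕ) < m - k := by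
  classical
  have hex : ∃ n : ℕ, ∀ h : n < m, ¬p ⟨n, h⟩ := ⟨m, fun h => absurd h (lt_irrefl m)⟩
  have hle : Nat.find hex ≤ m := Nat.find_min' hex fun h => absurd h (lt_irrefl m)
  have hpos : 0 < Nat.find hex := by
    rw [Nat.find_pos]
    exact fun h => h hm h0
  refine ⟨⟨m - Nat.find hex, by omega⟩, fun j => ?_⟩
  have hsub : m - (m - Nat.find hex) = Nat.find hex := by omega
  simp only [hsub]
  constructor
  · intro hj
    by_contra hlt
    have hlt' : Nat.find hex ≤ (j : ℕ) := not_lt.mp hlt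
    exact Nat.find_spec hex (hlt'.trans_lt j.2) (hp (show ⟨Nat.find hex, _⟩ ≤ j from hlt') hj)
  · intro hj
    have := Nat.find_min hex hj
    push Not at this
    exact this.2

theorem exists_eq_midpoint {m : ℕ} (hm : 1 ≤ m) {w : Fin m → ℝ} (hw : w ∈ monoBox m hm)
    (hint : ∀ j, ∃ z : ℤ, w j = z) :
    ∃ k l : Fin m, w = (2⁻¹ : ℝ) • (stepVec m k + stepVec m l) := by
  obtain ⟨h0, hmono, hbox⟩ := hw
  obtain ⟨k, hk⟩ := exists_threshold hm (fun j => w j < 2)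
    (fun a b hab h => (hmono hab).trans_lt h) (by simp [h0])
  obtain ⟨l, hl⟩ := exists_threshold hm (fun j => w j < 1)
    (fun a b hab h => (hmono hab).trans_lt h) (by simp [h0])
  refine ⟨k, l, funext fun j => ?_⟩
  obtain ⟨z, hz⟩ := hint j
  obtain ⟨hb0, hb2⟩ := hbox j
  have hkj := hk j
  have hlj := hl j
  simp only [Pi.smul_apply, Pi.add_apply, smul_eq_mul, stepVec, ← hkj, ← hlj]
  rw [hz] at hb0 hb2 ⊢
  have hz0 : 0 ≤ z := by exact_mod_cast hb0
  have hz2 : z ≤ 2 := by exact_mod_cast hb2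
  interval_cases z <;> norm_num

theorem exists_midpoint_of_mem {m : ℕ} (hm : 1 ≤ m) {x : (Fin m → ℝ) ⧸ line m}
    (hx : x ∈ convexHull ℝ (Set.range (stepPt m)) ∩ integralPts m) :
    ∃ k l : Fin m, x = (2⁻¹ : ℝ) • (stepPt m k + stepPt m l) := by
  obtain ⟨hx1, v, hv, hvx⟩ := hx
  obtain ⟨w, hw, rfl⟩ := convexHull_subset hm hx1
  obtain ⟨c, hc⟩ := (mkQ_eq_iff v w).1 hvx
  obtain ⟨z₀, hz₀⟩ := hv ⟨0, hm⟩
  have hint : ∀ j, ∃ z : ℤ, w j = z := fun j => by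
    obtain ⟨z, hz⟩ := hv j
    refine ⟨z - z₀, ?_⟩
    have h1 := hc j
    have h2 := hc ⟨0, hm⟩
    rw [hw.1] at h2
    push_cast
    linarith
  obtain ⟨k, l, rfl⟩ := exists_eq_midpoint hm hw hint
  exact ⟨k, l, (midpoint_eq k l).symm⟩

theorem midpoint_mem {m : ℕ} (k l : Fin m) :
    (2⁻¹ : ℝ) • (stepPt m k + stepPt m l) ∈
      convexHull ℝ (Set.range (stepPt m)) ∩ integralPts m := by
  constructor
  · rw [smul_add]
    exact convex_convexHull ℝ _ (subset_convexHull ℝ _ (Set.mem_range_self k))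
      (subset_convexHull ℝ _ (Set.mem_range_self l)) (by norm_num) (by norm_num) (by norm_num)
  · rw [midpoint_eq]
    refine ⟨_, fun j => ?_, rfl⟩
    simp only [Pi.smul_apply, Pi.add_apply, smul_eq_mul, stepVec]
    split_ifs
    · exact ⟨0, by norm_num⟩
    · exact ⟨1, by norm_num⟩
    · exact ⟨1, by norm_num⟩
    · exact ⟨2, by norm_num⟩

theorem stepVec_add_eq_zero_iff {m : ℕ} {k l : Fin m} (hkl : k ≤ l) (j : Fin m) :
    stepVec m k j + stepVec m l j = 0 ↔ (j : ℕ) < m - l := by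
  have hkl' : (k : ℕ) ≤ l := hkl
  unfold stepVec
  split_ifs <;> norm_num <;> omega

theorem stepVec_add_eq_four_iff {m : ℕ} {k l : Fin m} (hkl : k ≤ l) (j : Fin m) :
    stepVec m k j + stepVec m l j = 4 ↔ ¬(j : ℕ) < m - k := by
  have hkl' : (k : ℕ) ≤ l := hkl
  unfold stepVec
  split_ifs <;> norm_num <;> omega

theorem eq_of_threshold_iff {m : ℕ} {k l : Fin m}
    (h : ∀ j : Fin m, (j : ℕ) < m - k ↔ (j : ℕ) < m - l) : k = l := by
  have hk := k.2
  have hl := l.2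
  rcases lt_trichotomy (k : ℕ) l with hlt | heq | hlt
  · have := h ⟨m - l, by omega⟩
    simp only at this
    omega
  · exact Fin.ext heq
  · have := h ⟨m - k, by omega⟩
    simp only at this
    omega

theorem midpoint_injective {m : ℕ} (hm : 1 ≤ m) :
    Function.Injective (fun p : {p : Fin m × Fin m // p.1 ≤ p.2} =>
      (2⁻¹ : ℝ) • (stepPt m p.1.1 + stepPt m p.1.2)) := by
  rintro ⟨⟨k, l⟩, hkl⟩ ⟨⟨k', l'⟩, hkl'⟩ h
  simp only at hkl hkl'
  simp only [midpoint_eq] at h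
  obtain ⟨c, hc⟩ := (mkQ_eq_iff _ _).1 h
  simp only [Pi.smul_apply, Pi.add_apply, smul_eq_mul] at hc
  have hc0 := hc ⟨0, hm⟩
  simp only [stepVec_zero] at hc0
  have hsum : ∀ j, stepVec m k j + stepVec m l j = stepVec m k' j + stepVec m l' j := fun j => by
    have := hc j
    linarith
  have hl : l = l' := eq_of_threshold_iff fun j => by
    rw [← stepVec_add_eq_zero_iff hkl, ← stepVec_add_eq_zero_iff hkl', hsum]
  have hk : k = k' := eq_of_threshold_iff fun j => by
    rw [← not_iff_not, ← stepVec_add_eq_four_iff hkl, ← stepVec_add_eq_four_iff hkl', hsum]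
  subst hl hk
  rfl

theorem inter_eq_range {m : ℕ} (hm : 1 ≤ m) :
    convexHull ℝ (Set.range (stepPt m)) ∩ integralPts m =
      Set.range (fun p : {p : Fin m × Fin m // p.1 ≤ p.2} =>
        (2⁻¹ : ℝ) • (stepPt m p.1.1 + stepPt m p.1.2)) := by
  refine Set.Subset.antisymm (fun x hx => ?_) ?_
  · obtain ⟨k, l, rfl⟩ := exists_midpoint_of_mem hm hx
    rcases le_total k l with hkl | hkl
    · exact ⟨⟨(k, l), hkl⟩, rfl⟩
    · exact ⟨⟨(l, k), hkl⟩, by simp only [add_comm]⟩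
  · rintro _ ⟨p, rfl⟩
    exact midpoint_mem _ _

theorem inter_eq_union {m : ℕ} (hm : 1 ≤ m) :
    convexHull ℝ (Set.range (stepPt m)) ∩ integralPts m =
      Set.range (stepPt m) ∪
        {x | ∃ k l : Fin m, k < l ∧ x = (2⁻¹ : ℝ) • (stepPt m k + stepPt m l)} := by
  rw [inter_eq_range hm]
  ext x
  constructor
  · rintro ⟨⟨⟨k, l⟩, hkl⟩, rfl⟩
    rcases eq_or_lt_of_le hkl with h | h
    · simp only at h
      subst h
      exact Or.inl ⟨k, (midpoint_self k).symm⟩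
    · exact Or.inr ⟨k, l, h, rfl⟩
  · rintro (⟨i, rfl⟩ | ⟨k, l, hkl, rfl⟩)
    · exact ⟨⟨(i, i), le_rfl⟩, midpoint_self i⟩
    · exact ⟨⟨(k, l), hkl.le⟩, rfl⟩

theorem ncard_inter {m : ℕ} (hm : 1 ≤ m) :
    (convexHull ℝ (Set.range (stepPt m)) ∩ integralPts m).ncard = m * (m + 1) / 2 := by
  rw [inter_eq_range hm, ← Nat.card_coe_set_eq, Nat.card_range_of_injective (midpoint_injective hm),
    ← Nat.card_congr Sym2.sortEquiv, Nat.card_eq_fintype_card, Sym2.card, Fintype.card_fin,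
    Nat.choose_two_right, Nat.add_sub_cancel, Nat.mul_comm]

theorem midpoint_explicit {m : ℕ} {k l : Fin m} (hkl : k < l) :
    (2⁻¹ : ℝ) • (stepPt m k + stepPt m l) =
      (line m).mkQ (fun j => if (j : ℕ) < m - (l : ℕ) then 0
        else if (j : ℕ) < m - (k : ℕ) then 1 else 2) := by
  rw [midpoint_eq]
  congr 1
  funext j
  have hkl' : (k : ℕ) < l := hkl
  simp only [Pi.smul_apply, Pi.add_apply, smul_eq_mul, stepVec]
  split_ifs <;> first | omega | norm_num

end ChamberIntegralPoints


/-- In the quotient `V` of `ℝ^m` by the line `ℝ·(1,…,1)`, let `P i = q(0,…,0,2,…,2)` (with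
`m − i` zeros and `i` twos) for `0 ≤ i ≤ m−1`.  Then the integral points of the convex hull
of the `P i` are exactly the `P i` together with the midpoints `(P k + P l)/2` for `k < l`;
these points are pairwise distinct, so there are exactly `m(m+1)/2` of them, and explicitly
`(P k + P l)/2 = q(0,…,0,1,…,1,2,…,2)` with `m − l` zeros, `l − k` ones and `k` twos. -/
theorem stmt_5 (m : ℕ) (hm : 1 ≤ m) :
    let L : Submodule ℝ (Fin m → ℝ) := Submodule.span ℝ {(1 : Fin m → ℝ)}
    let q : (Fin m → ℝ) →ₗ[ℝ] ((Fin m → ℝ) ⧸ L) := L.mkQ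
    let P : Fin m → ((Fin m → ℝ) ⧸ L) :=
      fun i => q (fun j => if (j : ℕ) < m - (i : ℕ) then 0 else 2)
    let integral : Set ((Fin m → ℝ) ⧸ L) :=
      q '' {v : Fin m → ℝ | ∀ j, ∃ z : ℤ, v j = (z : ℝ)}
    (convexHull ℝ (Set.range P) ∩ integral =
      Set.range P ∪ {x | ∃ k l : Fin m, k < l ∧ x = (2⁻¹ : ℝ) • (P k + P l)}) ∧
    Function.Injective (fun p : {p : Fin m × Fin m // p.1 ≤ p.2} =>
      (2⁻¹ : ℝ) • (P p.1.1 + P p.1.2)) ∧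
    (convexHull ℝ (Set.range P) ∩ integral).ncard = m * (m + 1) / 2 ∧
    (∀ k l : Fin m, k < l → (2⁻¹ : ℝ) • (P k + P l) =
      q (fun j => if (j : ℕ) < m - (l : ℕ) then 0
        else if (j : ℕ) < m - (k : ℕ) then 1 else 2)) := by
  exact ⟨ChamberIntegralPoints.inter_eq_union hm, ChamberIntegralPoints.midpoint_injective hm,
    ChamberIntegralPoints.ncard_inter hm, fun _ _ hkl => ChamberIntegralPoints.midpoint_explicit hkl⟩
end

section
/- Let m ≥ 1. Let q : ℝ^{2m} → V denote the canonical projection onto the quotient V of ℝ^{2m} by the line ℝ·(1,…,1); a point of V is called integral if it lies in q(ℤ^{2m}). For 0 ≤ i ≤ m−1 let Q_i = q(v_i), where v_i ∈ ℝ^{2m} consists of m−i consecutive coordinate pairs (1/2, 0) followed by i consecutive coordinate pairs (1, 1/2). Then the convex hull of {Q_0, …, Q_{m−1}} in V contains no integral point. -/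
/-- In the quotient `V` of `ℝ^{2m}` by the line `ℝ·(1,…,1)`, let `Q i = q(v i)` where `v i`
consists of `m − i` coordinate pairs `(1/2, 0)` followed by `i` coordinate pairs `(1, 1/2)`.
Then the convex hull of the `Q i` contains no integral point. -/
theorem stmt_6 (m : ℕ) (hm : 1 ≤ m) :
    let L : Submodule ℝ (Fin (2 * m) → ℝ) := Submodule.span ℝ {(1 : Fin (2 * m) → ℝ)}
    let q : (Fin (2 * m) → ℝ) →ₗ[ℝ] ((Fin (2 * m) → ℝ) ⧸ L) := L.mkQ
    let Q : Fin m → ((Fin (2 * m) → ℝ) ⧸ L) := fun i =>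
      q (fun j => if (j : ℕ) / 2 < m - (i : ℕ)
          then (if (j : ℕ) % 2 = 0 then (1 / 2 : ℝ) else 0)
          else (if (j : ℕ) % 2 = 0 then 1 else (1 / 2 : ℝ)))
    convexHull ℝ (Set.range Q) ∩
      (q '' {v : Fin (2 * m) → ℝ | ∀ j, ∃ z : ℤ, v j = (z : ℝ)}) = ∅ := by
  intro L q Q
  let a : Fin (2 * m) := ⟨0, by omega⟩
  let b : Fin (2 * m) := ⟨1, by omega⟩
  -- The difference of the first two coordinates descends to the quotient.
  let d : (Fin (2 * m) → ℝ) →ₗ[ℝ] ℝ :=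
    LinearMap.proj (R := ℝ) (φ := fun _ => ℝ) a - LinearMap.proj (R := ℝ) (φ := fun _ => ℝ) b
  have hd : L ≤ LinearMap.ker d := by
    rw [Submodule.span_singleton_le_iff_mem]
    simp [d]
  have hf : ∀ v, L.liftQ d hd (q v) = v a - v b := fun v => L.liftQ_apply d v
  have hull : convexHull ℝ (Set.range Q) ⊆ {x | L.liftQ d hd x = 1 / 2} := by
    refine convexHull_min ?_ (convex_hyperplane (L.liftQ d hd).isLinear _)
    rintro _ ⟨i, rfl⟩
    have hi : 0 < m - (i : ℕ) := Nat.sub_pos_of_lt i.isLt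
    rw [Set.mem_ofPred_eq, hf]
    simp [a, b, hi]
  rw [Set.eq_empty_iff_forall_notMem]
  rintro _ ⟨hx, v, hv, rfl⟩
  have h : v a - v b = 1 / 2 := (hf v).symm.trans (hull hx)
  obtain ⟨y, hy⟩ := hv a
  obtain ⟨z, hz⟩ := hv b
  rw [hy, hz] at h
  have h' : ((2 * (y - z) : ℤ) : ℝ) = (1 : ℤ) := by push_cast; linarith
  have := Int.cast_injective h'
  omega
end

section
/- Let m ≥ 1. Let q : ℝ^{2m} → V denote the canonical projection onto the quotient V of ℝ^{2m} by the line ℝ·(1,…,1); a point of V is called integral if it lies in q(ℤ^{2m}). For 0 ≤ i ≤ m−1 let S_i = q(0,…,0,1,…,1), the image of the vector with 2m−2i coordinates equal to 0 followed by 2i coordinates equal to 1. Then the set of integral points of the convex hull of {S_0, …, S_{m−1}} in V is exactly {S_0, …, S_{m−1}}. -/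
/-- An integral point of the convex hull of a set of `0/1`-vectors belongs to that set. -/
theorem mem_of_mem_convexHull_of_zero_one {κ : Type*} {A : Set (κ → ℝ)}
    (hA : ∀ a ∈ A, ∀ j, a j = 0 ∨ a j = 1) {f : κ → ℝ} (hf : f ∈ convexHull ℝ A)
    (hint : ∀ j, ∃ z : ℤ, f j = z) : f ∈ A := by
  obtain ⟨ι, _, w, a, hw, hw1, ha, rfl⟩ := mem_convexHull_iff_exists_fintype.1 hf
  obtain ⟨i, -, hi⟩ : ∃ i ∈ Finset.univ, 0 < w i := by
    apply Finset.exists_lt_of_sum_lt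
    simp [hw1]
  suffices h : ∑ k, w k • a k = a i by
    rw [h]
    exact ha i
  ext j
  obtain ⟨z, hz⟩ := hint j
  have hsum : (∑ k, w k • a k) j = ∑ k, w k * a k j := by simp
  have hnonneg : ∀ k, 0 ≤ a k j := fun k => by rcases hA _ (ha k) j with h | h <;> simp [h]
  have hle : ∀ k, a k j ≤ 1 := fun k => by rcases hA _ (ha k) j with h | h <;> simp [h]
  have hlower : w i * a i j ≤ z := by
    rw [← hz, hsum]
    exact Finset.single_le_sum (f := fun k => w k * a k j)
      (fun k _ => mul_nonneg (hw k) (hnonneg k)) (Finset.mem_univ i)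
  have hupper : w i * (1 - a i j) ≤ 1 - z := by
    rw [← hz, hsum]
    have := Finset.single_le_sum (f := fun k => w k * (1 - a k j))
      (fun k _ => mul_nonneg (hw k) (sub_nonneg.2 (hle k))) (Finset.mem_univ i)
    simpa [mul_sub, hw1] using this
  rw [hz]
  rcases hA _ (ha i) j with h | h <;> rw [h] at hlower hupper ⊢
  · have h0 : (0 : ℝ) ≤ z := by linarith
    have h1 : (z : ℝ) < 1 := by linarith
    norm_cast at h0 h1 ⊢
    lia
  · have h0 : (0 : ℝ) < z := by linarith
    have h1 : (z : ℝ) ≤ 1 := by linarith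
    norm_cast at h0 h1 ⊢
    lia

/-- In the quotient `V` of `ℝ^{2m}` by the line `ℝ·(1,…,1)`, let `S i = q(0,…,0,1,…,1)` (with
`2m − 2i` zeros and `2i` ones) for `0 ≤ i ≤ m−1`.  Then the integral points of the convex
hull of the `S i` are exactly the `S i`. -/
theorem stmt_7 (m : ℕ) (hm : 1 ≤ m) :
    let L : Submodule ℝ (Fin (2 * m) → ℝ) := Submodule.span ℝ {(1 : Fin (2 * m) → ℝ)}
    let q : (Fin (2 * m) → ℝ) →ₗ[ℝ] ((Fin (2 * m) → ℝ) ⧸ L) := L.mkQ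
    let S : Fin m → ((Fin (2 * m) → ℝ) ⧸ L) := fun i =>
      q (fun j => if (j : ℕ) < 2 * m - 2 * (i : ℕ) then (0 : ℝ) else 1)
    convexHull ℝ (Set.range S) ∩
      (q '' {v : Fin (2 * m) → ℝ | ∀ j, ∃ z : ℤ, v j = (z : ℝ)}) = Set.range S := by
  intro L q S
  let s : Fin m → Fin (2 * m) → ℝ := fun i j =>
    if (j : ℕ) < 2 * m - 2 * (i : ℕ) then (0 : ℝ) else 1
  have hS : Set.range S = q '' Set.range s := by
    rw [← Set.range_comp]
    rfl
  apply Set.Subset.antisymm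
  · rintro x ⟨hx, v, hv, rfl⟩
    rw [hS, ← LinearMap.image_convexHull] at hx
    obtain ⟨f, hf, hfv⟩ := hx
    have hf0 : f ⟨0, by lia⟩ = 0 := by
      have hsub : convexHull ℝ (Set.range s) ⊆
          (LinearMap.ker (LinearMap.proj (R := ℝ) (φ := fun _ : Fin (2 * m) => ℝ) ⟨0, by lia⟩) :
            Set (Fin (2 * m) → ℝ)) := by
        apply convexHull_min _ (Submodule.convex _)
        rintro _ ⟨i, rfl⟩
        have hi := i.isLt
        have : 0 < 2 * m - 2 * (i : ℕ) := by lia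
        simp [s, this]
      exact hsub hf
    obtain ⟨c, hc⟩ := Submodule.mem_span_singleton.1 ((Submodule.Quotient.eq L).1 hfv)
    have hcoord : ∀ j, f j = v j + c := fun j => by
      have := congrFun hc j
      simp at this
      linarith
    rw [← hfv, hS]
    refine Set.mem_image_of_mem q (mem_of_mem_convexHull_of_zero_one ?_ hf fun j => ?_)
    · rintro _ ⟨i, rfl⟩ j
      exact ite_eq_or_eq _ _ _
    · obtain ⟨z, hz⟩ := hv j
      obtain ⟨y, hy⟩ := hv ⟨0, by lia⟩
      have := hcoord ⟨0, by lia⟩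
      refine ⟨z - y, ?_⟩
      push_cast
      linarith [hcoord j]
  · rintro _ ⟨i, rfl⟩
    refine ⟨subset_convexHull ℝ _ ⟨i, rfl⟩, Set.mem_image_of_mem q fun j => ?_⟩
    rcases ite_eq_or_eq ((j : ℕ) < 2 * m - 2 * (i : ℕ)) (0 : ℝ) 1 with h | h
    · exact ⟨0, by simpa using h⟩
    · exact ⟨1, by simpa using h⟩
end

section
/- Let k be a field with char k ≠ 2, let m ≥ 2 and 1 ≤ l ≤ m−1, and let w = diag(I_{m−l}, −I_l) ∈ GL_m(k) be the diagonal matrix whose first m−l diagonal entries are 1 and whose last l diagonal entries are −1. Suppose L is a k-subalgebra of the matrix algebra M_m(k) which is a field with dim_k L = m, and suppose w·L·w⁻¹ = L. Then m is even and l = m/2. -/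
open Matrix in
/-- If an invertible matrix anticommutes with a `±1` diagonal matrix over a field where `2 ≠ 0`,
both signs occur equally often on the diagonal. -/
theorem card_eq_of_anticommute_diagonal {k n : Type*} [Field k] [Fintype n] [DecidableEq n]
    (h2 : (2 : k) ≠ 0) (p : n → Prop) [DecidablePred p] (y : Matrix n n k) (hy : IsUnit y)
    (h : diagonal (fun i => if p i then (1 : k) else -1) * y =
      -(y * diagonal (fun i => if p i then (1 : k) else -1))) :
    Fintype.card {i // ¬ p i} = Fintype.card {i // p i} := by
  set w : Matrix n n k := diagonal (fun i => if p i then (1 : k) else -1) with hw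
  have hdet : IsUnit y.det := (isUnit_iff_isUnit_det y).1 hy
  have hsub : w - 1 = diagonal (fun i => if p i then (0 : k) else -2) := by
    rw [hw, ← diagonal_one, diagonal_sub]
    congr 1
    ext i
    split_ifs <;> norm_num
  have hadd : -(w + 1) = diagonal (fun i => if p i then (-2 : k) else 0) := by
    rw [hw, ← diagonal_one, diagonal_add, diagonal_neg]
    congr 1
    ext i
    split_ifs <;> norm_num [*]
  have hmul : (w - 1) * y = y * -(w + 1) := by
    rw [sub_mul, h, mul_neg, mul_add, one_mul, mul_one, neg_add, sub_eq_add_neg]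
  have hrank : (w - 1).rank = (-(w + 1)).rank := by
    rw [← rank_mul_eq_left_of_isUnit_det y (w - 1) hdet, hmul,
      rank_mul_eq_right_of_isUnit_det y _ hdet]
  classical
  rw [hsub, hadd, rank_diagonal, rank_diagonal] at hrank
  have e₁ : Fintype.card {i // (if p i then (0 : k) else -2) ≠ 0} =
      Fintype.card {i // ¬ p i} :=
    Fintype.card_congr (Equiv.subtypeEquivRight fun i => by split_ifs <;> simp [*])
  have e₂ : Fintype.card {i // (if p i then (-2 : k) else 0) ≠ 0} = Fintype.card {i // p i} :=
    Fintype.card_congr (Equiv.subtypeEquivRight fun i => by split_ifs <;> simp [*])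
  rw [← e₁, ← e₂]
  convert hrank

/-- A nonzero element of a subalgebra which is a field is a unit of the ambient algebra. -/
theorem Subalgebra.isUnit_of_isField {k A : Type*} [Field k] [Ring A] [Algebra k A]
    {L : Subalgebra k A} (hL : IsField L) {x : A} (hx : x ∈ L) (hx0 : x ≠ 0) : IsUnit x := by
  obtain ⟨z, hz⟩ := hL.mul_inv_cancel (a := ⟨x, hx⟩) (fun h => hx0 (congrArg Subtype.val h))
  have hz' := (hL.mul_comm z ⟨x, hx⟩).trans hz
  exact ⟨⟨x, z, congrArg Subtype.val hz, congrArg Subtype.val hz'⟩, rfl⟩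

open Matrix in
/-- A subfield of the matrix algebra of full dimension acts transitively on nonzero vectors. -/
theorem Subalgebra.exists_mulVec_eq_of_isField {k n : Type*} [Field k] [Fintype n] [DecidableEq n]
    {L : Subalgebra k (Matrix n n k)} (hL : IsField L)
    (hdim : Module.finrank k L = Fintype.card n) {v : n → k} (hv : v ≠ 0) (u : n → k) :
    ∃ x ∈ L, x *ᵥ v = u := by
  let f : L →ₗ[k] (n → k) := ((mulVecBilin k k).flip v).comp L.val.toLinearMap
  have hf (x : L) : f x = (x : Matrix n n k) *ᵥ v := rfl
  have hinj : Function.Injective f := by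
    rw [injective_iff_map_eq_zero]
    intro x hx
    by_contra hx0
    have hu := Subalgebra.isUnit_of_isField hL x.2 (fun h => hx0 (Subtype.ext h))
    refine hv (mulVec_injective_of_isUnit hu ?_)
    rw [mulVec_zero, ← hf, hx]
  have hsurj : Function.Surjective f :=
    (LinearMap.injective_iff_surjective_of_finrank_eq_finrank (by simp [hdim])).1 hinj
  obtain ⟨x, hx⟩ := hsurj u
  exact ⟨x, x.2, hx⟩


/-- Let `k` be a field of characteristic `≠ 2`, `m ≥ 2`, `1 ≤ l ≤ m − 1`, and
`w = diag(I_{m−l}, −I_l)`.  If `L` is a `k`-subalgebra of `M_m(k)` which is a field with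
`dim_k L = m` and `w·L·w⁻¹ = L`, then `m` is even and `l = m/2`. -/
theorem stmt_8 {k : Type*} [Field k] (hchar : ringChar k ≠ 2)
    (m l : ℕ) (hm : 2 ≤ m) (hl1 : 1 ≤ l) (hl2 : l ≤ m - 1)
    (L : Subalgebra k (Matrix (Fin m) (Fin m) k))
    (hfield : IsField L)
    (hdim : Module.finrank k L = m)
    (w : Matrix (Fin m) (Fin m) k)
    (hw : w = Matrix.diagonal (fun i : Fin m => if (i : ℕ) < m - l then (1 : k) else -1))
    (hconj : (fun x => w * x * w⁻¹) '' (L : Set (Matrix (Fin m) (Fin m) k)) = L) :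
    Even m ∧ l = m / 2 := by
  have h2 : (2 : k) ≠ 0 := Ring.two_ne_zero hchar
  have hww : w * w = 1 := by
    rw [hw, Matrix.diagonal_mul_diagonal, ← Matrix.diagonal_one]
    congr 1
    ext i
    split_ifs <;> norm_num
  have hinv : w⁻¹ = w := Matrix.inv_eq_right_inv hww
  rw [hinv] at hconj
  by_cases hcomm : ∀ x ∈ L, w * x * w = x
  · exfalso
    let a : Fin m := ⟨0, by omega⟩
    let b : Fin m := ⟨m - 1, by omega⟩
    obtain ⟨x, hx, hxv⟩ := Subalgebra.exists_mulVec_eq_of_isField hfield (by simpa using hdim)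
      (v := Pi.single a (1 : k)) (by simp) (Pi.single b 1)
    have hwa : w.mulVec (Pi.single a 1) = Pi.single a 1 := by
      have : 0 < m - l := by omega
      simp [hw, a, this]
    have hwb : w.mulVec (Pi.single b 1) = Pi.single b (-1) := by
      have : ¬ m - 1 < m - l := by omega
      rw [hw, Matrix.diagonal_mulVec_single]
      simp [b, this]
    have key := congrArg (fun y => y.mulVec (Pi.single a (1 : k))) (hcomm x hx)
    simp only [← Matrix.mulVec_mulVec, hwa, hxv, hwb] at key
    have h1 : (-1 : k) = 1 := Pi.single_injective b key
    exact h2 (by linear_combination -h1)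
  · push Not at hcomm
    obtain ⟨x, hx, hne⟩ := hcomm
    have hwx : w * x * w ∈ L := by
      have : w * x * w ∈ (L : Set (Matrix (Fin m) (Fin m) k)) := hconj ▸ ⟨x, hx, rfl⟩
      exact this
    have hu : IsUnit (x - w * x * w) := Subalgebra.isUnit_of_isField hfield
      (L.sub_mem hx hwx) (sub_ne_zero.2 hne.symm)
    have hanti : w * (x - w * x * w) = -((x - w * x * w) * w) := by
      have e₁ : w * (w * x * w) = x * w := by rw [← mul_assoc, ← mul_assoc, hww, one_mul]
      have e₂ : w * x * w * w = w * x := by rw [mul_assoc, hww, mul_one]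
      rw [mul_sub, sub_mul, e₁, e₂, neg_sub]
    have hcard := card_eq_of_anticommute_diagonal h2 (fun i : Fin m => (i : ℕ) < m - l) _ hu
      (hw ▸ hanti)
    have hlt : Fintype.card {i : Fin m // (i : ℕ) < m - l} = m - l := by
      rw [Fintype.card_subtype, Fin.card_filter_val_lt]
      omega
    rw [Fintype.card_subtype_compl, hlt, Fintype.card_fin] at hcard
    exact ⟨⟨l, by omega⟩, by omega⟩
end

section
/- Let k ⊆ K ⊆ E be finite fields with [K : k] = 2 and [E : K] = m, and let σ be a generator of the Galois group Gal(E/k), which is cyclic of order 2m. Let χ : Eˣ → ℂˣ be a group homomorphism which is K-regular. If there exists α ∈ Gal(E/K) such that χ(α(x))⁻¹ = χ(σ(x)) for all x ∈ Eˣ, then m is odd. -/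
/-- In a finite cyclic group with a subgroup `H` of index two, the existence of an involution
outside `H` forces `H` to have odd order. -/
theorem odd_card_of_index_two_of_sq_eq_one {G : Type*} [Group G] [Finite G] {σ β : G}
    (hσ : ∀ τ : G, τ ∈ Subgroup.zpowers σ) {H : Subgroup G} (hH : H.index = 2)
    (hβ : β ∉ H) (hβ2 : β ^ 2 = 1) : Odd (Nat.card H) := by
  obtain ⟨i, rfl⟩ := Subgroup.mem_zpowers_iff.mp (hσ β)
  have hi : Odd i := by
    by_contra hi
    obtain ⟨j, rfl⟩ := Int.not_odd_iff_even.mp hi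
    exact hβ (by rw [zpow_add]; exact H.mul_self_mem_of_index_two hH _)
  have hcard : orderOf σ = 2 * Nat.card H := by
    rw [orderOf_eq_card_of_forall_mem_zpowers hσ, ← H.card_mul_index, hH, mul_comm]
  have hdvd : ((2 * Nat.card H : ℕ) : ℤ) ∣ 2 * i := by
    rw [← hcard, orderOf_dvd_iff_zpow_eq_one, mul_comm, zpow_mul]
    exact_mod_cast hβ2
  rw [Nat.cast_mul, Nat.cast_ofNat, mul_dvd_mul_iff_left two_ne_zero] at hdvd
  obtain ⟨c, rfl⟩ := hdvd
  exact_mod_cast (Int.odd_mul.mp hi).1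

/-- Let `k ⊆ K ⊆ E` be finite fields with `[K : k] = 2` and `[E : K] = m`, let `σ` be a
generator of `Gal(E/k)`, and let `χ : Eˣ → ℂˣ` be a `K`-regular character.  If there is
`α ∈ Gal(E/K)` with `χ(α(x))⁻¹ = χ(σ(x))` for all `x ∈ Eˣ`, then `m` is odd. -/
theorem stmt_11 {k K E : Type*} [Field k] [Field K] [Field E] [Finite E]
    [Algebra k K] [Algebra K E] [Algebra k E] [IsScalarTower k K E]
    (m : ℕ) (hK : Module.finrank k K = 2) (hE : Module.finrank K E = m)
    (σ : E ≃ₐ[k] E) (hσ : ∀ τ : E ≃ₐ[k] E, τ ∈ Subgroup.zpowers σ)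
    (χ : Eˣ →* ℂˣ)
    (hreg : ∀ α : E ≃ₐ[K] E,
      (∀ x : Eˣ, χ (Units.map (α : E →* E) x) = χ x) → α = AlgEquiv.refl)
    (h : ∃ α : E ≃ₐ[K] E, ∀ x : Eˣ,
        (χ (Units.map (α : E →* E) x))⁻¹ = χ (Units.map (σ : E →* E) x)) :
    Odd m := by
  obtain ⟨α, hα⟩ := h
  let ι : (E ≃ₐ[K] E) →* (E ≃ₐ[k] E) := AlgEquiv.restrictScalarsHom k
  have hι : Function.Injective ι := AlgEquiv.restrictScalarsHom_injective k
  have hcard : Nat.card ι.range = m := by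
    rw [← Nat.card_congr (MonoidHom.ofInjective hι).toEquiv, IsGalois.card_aut_eq_finrank, hE]
  have hm : 0 < m := hE ▸ Module.finrank_pos
  have hindex : ι.range.index = 2 := by
    have := ι.range.card_mul_index
    rw [hcard, IsGalois.card_aut_eq_finrank, ← Module.finrank_mul_finrank k K E, hK, hE,
      mul_comm 2] at this
    exact Nat.eq_of_mul_eq_mul_left hm this
  have hσι : σ ∉ ι.range := fun hmem => by
    have htop : ι.range = ⊤ := eq_top_iff.mpr fun τ _ => Subgroup.zpowers_le.mpr hmem (hσ τ)
    simp [htop] at hindex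
  have hβι : σ * (ι α)⁻¹ ∉ ι.range := fun hmem =>
    hσι ((ι.range.mul_mem_cancel_right (inv_mem (MonoidHom.mem_range.mpr ⟨α, rfl⟩))).mp hmem)
  have hβχ (x : Eˣ) :
      χ (Units.map ((σ * (ι α)⁻¹ : E ≃ₐ[k] E) : E →* E) x) = (χ x)⁻¹ := by
    have key := hα (Units.map ((α⁻¹ : E ≃ₐ[K] E) : E →* E) x)
    have hx : Units.map (α : E →* E) (Units.map ((α⁻¹ : E ≃ₐ[K] E) : E →* E) x) = x :=
      Units.ext (α.apply_symm_apply x)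
    rw [hx] at key
    rw [key]
    rfl
  obtain ⟨γ, hγ⟩ : (σ * (ι α)⁻¹) ^ 2 ∈ ι.range := Subgroup.sq_mem_of_index_two hindex _
  have hγ1 : γ = 1 := hreg γ fun x => by
    have hx : Units.map (γ : E →* E) x =
        Units.map ((σ * (ι α)⁻¹ : E ≃ₐ[k] E) : E →* E)
          (Units.map ((σ * (ι α)⁻¹ : E ≃ₐ[k] E) : E →* E) x) := by
      rw [pow_two] at hγ
      exact Units.ext (DFunLike.congr_fun hγ (x : E))
    rw [hx, hβχ, hβχ, inv_inv]
  rw [← hcard]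
  exact odd_card_of_index_two_of_sq_eq_one hσ hindex hβι (by rw [← hγ, hγ1, map_one])
end

section
/- Let k_F ⊆ k_K ⊆ k_Δ ⊆ E be finite fields with [k_K : k_F] = 2, [k_Δ : k_K] = d and [E : k_Δ] = m, where d and m are odd. Let τ be a generator of the Galois group Gal(E/k_F), which is cyclic of order 2dm. Let χ : Eˣ → ℂˣ be a group homomorphism which is k_K-regular. Then the following are equivalent: (i) there exists γ ∈ Gal(E/k_K) with χ(γ(x))⁻¹ = χ(τ(x)) for all x ∈ Eˣ; (ii) there exists α ∈ Gal(E/k_Δ) with χ(α(x))⁻¹ = χ(τ^d(x)) for all x ∈ Eˣ. -/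
/-- The combinatorial core: if `χ` has no nontrivial stabilizer among the even powers of an
element `τ` of order `2dm`, then `χ⁻¹` is a translate of `χ` by an odd power of `τ` if and only if
it is one by an odd power of `τ ^ d`. -/
theorem exists_even_zpow_smul_inv_iff {G X A : Type*} [Group G] [MulAction G X]
    [InvolutiveInv A] {d m : ℕ} (hd : Odd d) (τ : G) (hτ : orderOf τ = 2 * d * m) (χ : X → A)
    (hreg : ∀ i : ℤ, 2 ∣ i → (∀ x, χ (τ ^ i • x) = χ x) → τ ^ i = 1) :
    (∃ i : ℤ, 2 ∣ i ∧ ∀ x, (χ (τ ^ i • x))⁻¹ = χ (τ • x)) ↔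
      ∃ i : ℤ, (2 * d : ℤ) ∣ i ∧ ∀ x, (χ (τ ^ i • x))⁻¹ = χ (τ ^ d • x) := by
  constructor
  · rintro ⟨i, ⟨k, rfl⟩, h⟩
    have hinv (x : X) : χ (τ ^ (2 * k - 1) • x) = (χ x)⁻¹ := by
      have := h (τ⁻¹ • x)
      rw [smul_inv_smul, smul_smul, ← zpow_sub_one] at this
      rw [← this, inv_inv]
    have hone : τ ^ (2 * (2 * k - 1)) = 1 := by
      refine hreg _ (dvd_mul_right _ _) fun x ↦ ?_
      rw [two_mul, zpow_add, mul_smul, hinv, hinv, inv_inv]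
    obtain ⟨l, hl⟩ : (d : ℤ) ∣ 2 * k - 1 := by
      have := orderOf_dvd_iff_zpow_eq_one.mpr hone
      rw [hτ] at this
      push_cast at this
      rw [mul_assoc] at this
      exact (dvd_mul_right _ _).trans (Int.dvd_of_mul_dvd_mul_left (by norm_num) this)
    have hl_odd : Odd l := by
      have : Odd ((d : ℤ) * l) := hl ▸ ⟨k - 1, by ring⟩
      exact (Int.odd_mul.mp this).2
    obtain ⟨t, rfl⟩ := hl_odd
    refine ⟨2 * d * (t + 1), dvd_mul_right _ _, fun x ↦ ?_⟩
    have he : (2 * d * (t + 1) : ℤ) = (2 * k - 1) + d := by rw [hl]; ring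
    rw [he, zpow_add, mul_smul, hinv, inv_inv, zpow_natCast]
  · rintro ⟨_, ⟨k, rfl⟩, h⟩
    obtain ⟨e, rfl⟩ := hd
    refine ⟨2 * ((2 * e + 1) * k - e), dvd_mul_right _ _, fun x ↦ ?_⟩
    have := h (τ ^ (-(2 * e : ℤ)) • x)
    rw [smul_smul, smul_smul, ← zpow_natCast, ← zpow_add, ← zpow_add] at this
    push_cast at this
    convert this using 4
    · congr 1; ring
    · rw [show (2 * e + 1 + -(2 * e) : ℤ) = 1 by ring, zpow_one]

/-- For finite fields `F ⊆ L ⊆ E` and a generator `τ` of `Gal(E/F)`, the power `τ ^ i` is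
`L`-linear if and only if `[L : F]` divides `i`. -/
theorem exists_restrictScalars_eq_zpow_iff {F L E : Type*} [Field F] [Field L] [Field E]
    [Finite E] [Algebra F L] [Algebra F E] [Algebra L E] [IsScalarTower F L E]
    (τ : E ≃ₐ[F] E) (hτ : ∀ s : E ≃ₐ[F] E, s ∈ Subgroup.zpowers τ) (i : ℤ) :
    (∃ g : E ≃ₐ[L] E, g.restrictScalars F = τ ^ i) ↔ (Module.finrank F L : ℤ) ∣ i := by
  have : Finite L := Finite.of_injective _ (algebraMap L E).injective
  have : Finite F := Finite.of_injective _ (algebraMap F E).injective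
  have hord : orderOf (AlgEquiv.restrictNormalHom L τ) = Module.finrank F L := by
    rw [← IsGalois.card_aut_eq_finrank]
    refine orderOf_eq_card_of_forall_mem_zpowers fun s ↦ ?_
    obtain ⟨s, rfl⟩ := AlgEquiv.restrictNormalHom_surjective (F := F) (K₁ := L) E s
    obtain ⟨k, rfl⟩ := hτ s
    exact ⟨k, (map_zpow _ _ _).symm⟩
  rw [← hord, orderOf_dvd_iff_zpow_eq_one, ← map_zpow]
  generalize τ ^ i = σ
  constructor
  · rintro ⟨g, rfl⟩
    ext x
    apply (algebraMap L E).injective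
    exact (AlgEquiv.restrictNormal_commutes _ L x).trans (g.commutes x)
  · intro h
    refine ⟨AlgEquiv.ofRingEquiv (f := σ.toRingEquiv) fun x ↦ ?_, by ext; rfl⟩
    have := AlgEquiv.restrictNormal_commutes σ L x
    rw [show σ.restrictNormal L = 1 from h] at this
    exact this.symm

/-- Let `k_F ⊆ k_K ⊆ k_Δ ⊆ E` be finite fields with `[k_K : k_F] = 2`, `[k_Δ : k_K] = d`,
`[E : k_Δ] = m` with `d`, `m` odd.  Let `τ` be a generator of `Gal(E/k_F)` and
`χ : Eˣ → ℂˣ` a `k_K`-regular character.  Then there exists `γ ∈ Gal(E/k_K)` with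
`χ(γ(x))⁻¹ = χ(τ(x))` for all `x` if and only if there exists `α ∈ Gal(E/k_Δ)` with
`χ(α(x))⁻¹ = χ(τ^d(x))` for all `x`. -/
theorem stmt_12 {F K Δ E : Type*} [Field F] [Field K] [Field Δ] [Field E] [Finite E]
    [Algebra F K] [Algebra F Δ] [Algebra F E] [Algebra K Δ] [Algebra K E] [Algebra Δ E]
    [IsScalarTower F K Δ] [IsScalarTower F K E] [IsScalarTower F Δ E] [IsScalarTower K Δ E]
    (d m : ℕ) (hd : Odd d) (hm : Odd m)
    (h1 : Module.finrank F K = 2) (h2 : Module.finrank K Δ = d)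
    (h3 : Module.finrank Δ E = m)
    (τ : E ≃ₐ[F] E) (hτ : ∀ s : E ≃ₐ[F] E, s ∈ Subgroup.zpowers τ)
    (χ : Eˣ →* ℂˣ)
    (hreg : ∀ α : E ≃ₐ[K] E,
      (∀ x : Eˣ, χ (Units.map (α : E →* E) x) = χ x) → α = AlgEquiv.refl) :
    (∃ γ : E ≃ₐ[K] E, ∀ x : Eˣ,
        (χ (Units.map (γ : E →* E) x))⁻¹ = χ (Units.map (τ : E →* E) x)) ↔
    (∃ α : E ≃ₐ[Δ] E, ∀ x : Eˣ,
        (χ (Units.map (α : E →* E) x))⁻¹ = χ (Units.map ((τ ^ d : E ≃ₐ[F] E) : E →* E) x)) := by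
  have : Finite F := Finite.of_injective _ (algebraMap F E).injective
  have : Finite Δ := Finite.of_injective _ (algebraMap Δ E).injective
  have hFΔ : Module.finrank F Δ = 2 * d := by rw [← Module.finrank_mul_finrank F K Δ, h1, h2]
  have hord : orderOf τ = 2 * d * m := by
    rw [orderOf_eq_card_of_forall_mem_zpowers hτ, IsGalois.card_aut_eq_finrank,
      ← Module.finrank_mul_finrank F Δ E, hFΔ, h3]
  have hK (i : ℤ) := exists_restrictScalars_eq_zpow_iff (L := K) τ hτ i
  have hΔ (i : ℤ) := exists_restrictScalars_eq_zpow_iff (L := Δ) τ hτ i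
  rw [h1] at hK
  rw [hFΔ] at hΔ
  push_cast at hK hΔ
  have hsmul (s : E ≃ₐ[F] E) (x : Eˣ) : Units.map (s : E →* E) x = s • x := by ext; rfl
  have hsmulK (g : E ≃ₐ[K] E) (x : Eˣ) :
      Units.map (g : E →* E) x = g.restrictScalars F • x := by ext; rfl
  have hsmulΔ (g : E ≃ₐ[Δ] E) (x : Eˣ) :
      Units.map (g : E →* E) x = g.restrictScalars F • x := by ext; rfl
  simp only [hsmul, hsmulK, hsmulΔ] at hreg ⊢
  have hcore := exists_even_zpow_smul_inv_iff (m := m) hd τ hord χ fun i hi h ↦ by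
    obtain ⟨g, hg⟩ := (hK i).mpr hi
    rw [← hg] at h ⊢
    rw [hreg g h]
    rfl
  refine (iff_congr ?_ ?_).mpr hcore
  · constructor
    · rintro ⟨g, h⟩
      obtain ⟨i, hi⟩ := hτ (g.restrictScalars F)
      exact ⟨i, (hK i).mp ⟨g, hi.symm⟩, by simpa only [← hi] using h⟩
    · rintro ⟨i, hi, h⟩
      obtain ⟨g, hg⟩ := (hK i).mpr hi
      exact ⟨g, by rwa [hg]⟩
  · constructor
    · rintro ⟨g, h⟩
      obtain ⟨i, hi⟩ := hτ (g.restrictScalars F)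
      exact ⟨i, (hΔ i).mp ⟨g, hi.symm⟩, by simpa only [← hi] using h⟩
    · rintro ⟨i, hi, h⟩
      obtain ⟨g, hg⟩ := (hΔ i).mpr hi
      exact ⟨g, by rwa [hg]⟩
end
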